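/- arXiv:math/0506339 — 4 statements merged into one kernel-verified Lean document; each statement's English description precedes it below -/
import Mathlib

section
/- For every g ∈ G and γ ∈ Γ, the element g^γ is the identity element of the derived group G_ρ if and only if g is the identity element of G. -/
/-- The defining relators of Crowell's derived group of the permutation
representation associated to a right action `act` of `G` on `Γ`:
`(γ, g*h) * ((γ, g) * (γ·g, h))⁻¹` for `g, h ∈ G` and `γ ∈ Γ`. -/
def derivedRels {Γ : Type*} {G : Type*} [Group G] (act : Γ → G → Γ) :
    Set (FreeGroup (Γ × G)) :=
  {r | ∃ (γ : Γ) (g h : G),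
    r = FreeGroup.of (γ, g * h) *
      (FreeGroup.of (γ, g) * FreeGroup.of (act γ g, h))⁻¹}

/-- Crowell's derived group `G_ρ`. -/
def DerivedGroup {Γ : Type*} {G : Type*} [Group G] (act : Γ → G → Γ) :=
  PresentedGroup (derivedRels act)

instance {Γ : Type*} {G : Type*} [Group G] (act : Γ → G → Γ) :
    Group (DerivedGroup act) :=
  inferInstanceAs (Group (PresentedGroup (derivedRels act)))

/-- The generator `g^γ` of the derived group. -/
def derivedGen {Γ : Type*} {G : Type*} [Group G] (act : Γ → G → Γ)
    (γ : Γ) (g : G) : DerivedGroup act :=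
  PresentedGroup.of (rels := derivedRels act) (γ, g)

theorem derivedGen_mul {Γ : Type*} {G : Type*} [Group G] (act : Γ → G → Γ)
    (γ : Γ) (g h : G) :
    derivedGen act γ (g * h) = derivedGen act γ g * derivedGen act (act γ g) h := by
  have hr : PresentedGroup.mk (derivedRels act) (FreeGroup.of (γ, g * h) *
      (FreeGroup.of (γ, g) * FreeGroup.of (act γ g, h))⁻¹) = 1 :=
    PresentedGroup.one_of_mem ⟨γ, g, h, rfl⟩
  rw [map_mul, map_inv, mul_inv_eq_one, map_mul] at hr
  exact hr

/-- The canonical projection `G_ρ → G`, sending `g^γ` to `g`. -/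
def derivedProj {Γ : Type*} {G : Type*} [Group G] (act : Γ → G → Γ) :
    DerivedGroup act →* G :=
  PresentedGroup.toGroup (f := Prod.snd) <| by
    rintro _ ⟨γ, g, h, rfl⟩
    simp

theorem derivedProj_derivedGen {Γ : Type*} {G : Type*} [Group G] (act : Γ → G → Γ)
    (γ : Γ) (g : G) : derivedProj act (derivedGen act γ g) = g :=
  PresentedGroup.toGroup.of _

theorem derived_gen_eq_one_iff {Γ : Type*} {G : Type*} [Group G] [Nonempty Γ]
    (act : Γ → G → Γ)
    (act_one : ∀ γ : Γ, act γ 1 = γ)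
    (act_mul : ∀ (γ : Γ) (g h : G), act γ (g * h) = act (act γ g) h)
    (g : G) (γ : Γ) :
    derivedGen act γ g = 1 ↔ g = 1 := by
  constructor
  · intro h
    rw [← derivedProj_derivedGen act γ g, h, map_one]
  · rintro rfl
    have h := derivedGen_mul act γ 1 1
    rwa [act_one, mul_one, left_eq_mul] at h
end

section
/- Normal forms in the derived group are unique: if g₁^{γ₁} ⋯ g_n^{γ_n} = h₁^{δ₁} ⋯ h_m^{δ_m} in G_ρ, where g_k ≠ 1 and γ_{k+1} ≠ γ_k·g_k for 1 ≤ k < n, and h_k ≠ 1 and δ_{k+1} ≠ δ_k·h_k for 1 ≤ k < m, then n = m and (γ_k, g_k) = (δ_k, h_k) for all 1 ≤ k ≤ n. -/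
open Classical in
/-- Left multiplication of a word by the generator `(γ, g)`, followed by reduction. -/
noncomputable def derivedPush {Γ : Type*} {G : Type*} [Group G] (act : Γ → G → Γ)
    (γ : Γ) (g : G) : List (Γ × G) → List (Γ × G)
  | [] => if g = 1 then [] else [(γ, g)]
  | p :: T =>
    if g = 1 then p :: T
    else if p.1 = act γ g then
      if g * p.2 = 1 then T else (γ, g * p.2) :: T
    else (γ, g) :: p :: T

/-- A word is reduced if no letter is trivial and no two consecutive letters are composable. -/
def DerivedReduced {Γ : Type*} {G : Type*} [Group G] (act : Γ → G → Γ)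
    (L : List (Γ × G)) : Prop :=
  (∀ p ∈ L, p.2 ≠ 1) ∧ L.IsChain (fun p q => q.1 ≠ act p.1 p.2)

section

variable {Γ : Type*} {G : Type*} [Group G] {act : Γ → G → Γ}

theorem derivedPush_one (γ : Γ) (L : List (Γ × G)) : derivedPush act γ 1 L = L := by
  cases L <;> simp [derivedPush]

theorem DerivedReduced.tail {p : Γ × G} {T : List (Γ × G)}
    (h : DerivedReduced act (p :: T)) : DerivedReduced act T :=
  ⟨fun q hq => h.1 q (List.mem_cons_of_mem _ hq), h.2.tail⟩

/-- Pushing a letter onto a word with which it forms a reduced word just prepends it. -/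
theorem DerivedReduced.push_eq_cons {p : Γ × G} {T : List (Γ × G)}
    (h : DerivedReduced act (p :: T)) : derivedPush act p.1 p.2 T = p :: T := by
  have hp : p.2 ≠ 1 := h.1 p List.mem_cons_self
  cases T with
  | nil => simp [derivedPush, hp]
  | cons q T =>
    have hq : q.1 ≠ act p.1 p.2 := (List.isChain_cons_cons.1 h.2).1
    simp [derivedPush, hp, hq]

/-- A reduced word stays reduced when its first letter is replaced by a nontrivial letter with
the same endpoint. -/
theorem DerivedReduced.replace_head {p q : Γ × G} {T : List (Γ × G)}
    (h : DerivedReduced act (p :: T)) (hq : q.2 ≠ 1) (hpq : act q.1 q.2 = act p.1 p.2) :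
    DerivedReduced act (q :: T) := by
  refine ⟨fun r hr => ?_, ?_⟩
  · rcases List.mem_cons.1 hr with rfl | hr
    · exact hq
    · exact h.1 r (List.mem_cons_of_mem _ hr)
  · cases T with
    | nil => exact List.isChain_singleton _
    | cons r T =>
      have hc := List.isChain_cons_cons.1 h.2
      exact List.isChain_cons_cons.2 ⟨hpq ▸ hc.1, hc.2⟩

theorem DerivedReduced.push (act_mul : ∀ (γ : Γ) (g h : G), act γ (g * h) = act (act γ g) h)
    {L : List (Γ × G)} (hL : DerivedReduced act L) (γ : Γ) (g : G) :
    DerivedReduced act (derivedPush act γ g L) := by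
  by_cases hg : g = 1
  · subst hg
    rwa [derivedPush_one]
  cases L with
  | nil => simp [derivedPush, hg, DerivedReduced]
  | cons p T =>
    simp only [derivedPush, if_neg hg]
    split_ifs with hp hm
    · exact hL.tail
    · exact hL.replace_head hm (by simp [act_mul, hp])
    · refine ⟨fun r hr => ?_, List.isChain_cons_cons.2 ⟨hp, hL.2⟩⟩
      rcases List.mem_cons.1 hr with rfl | hr
      · exact hg
      · exact hL.1 r hr

theorem DerivedReduced.push_mul (act_one : ∀ γ : Γ, act γ 1 = γ)
    (act_mul : ∀ (γ : Γ) (g h : G), act γ (g * h) = act (act γ g) h)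
    {L : List (Γ × G)} (hL : DerivedReduced act L) (γ : Γ) (g h : G) :
    derivedPush act γ (g * h) L = derivedPush act γ g (derivedPush act (act γ g) h L) := by
  by_cases hg : g = 1
  · subst hg
    simp [derivedPush_one, act_one]
  by_cases hh : h = 1
  · subst hh
    simp [derivedPush_one]
  cases L with
  | nil => simp [derivedPush, hg, hh]
  | cons p T =>
    obtain ⟨δ, k⟩ := p
    by_cases hδ : δ = act γ (g * h)
    · by_cases hk : h * k = 1
      · have hT : derivedPush act γ g T = (γ, g) :: T := by
          refine (hL.replace_head (q := (γ, g)) hg ?_).push_eq_cons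
          simp [hδ, ← act_mul, mul_assoc, hk]
        have hR : derivedPush act (act γ g) h ((δ, k) :: T) = T := by
          simp [derivedPush, hh, hδ, hk, act_mul]
        rw [hR, hT]
        by_cases hgh : g * h = 1
        · have hgk : g = k := by
            rw [eq_inv_of_mul_eq_one_left hgh, eq_inv_of_mul_eq_one_right hk]
          rw [hgh, derivedPush_one, hδ, hgh, act_one, hgk]
        · simp [derivedPush, hgh, hδ, mul_assoc, hk, hg]
      · have hR : derivedPush act (act γ g) h ((δ, k) :: T) = (act γ g, h * k) :: T := by
          simp [derivedPush, hh, hδ, hk, act_mul]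
        rw [hR]
        by_cases hgh : g * h = 1
        · have hk1 : k ≠ 1 := hL.1 (δ, k) List.mem_cons_self
          rw [hgh, derivedPush_one, hδ, hgh, act_one]
          simp [derivedPush, hg, ← mul_assoc, hgh, hk1]
        · by_cases hghk : g * (h * k) = 1 <;> simp [derivedPush, hgh, hδ, mul_assoc, hg, hghk]
    · have hR : derivedPush act (act γ g) h ((δ, k) :: T) = (act γ g, h) :: (δ, k) :: T := by
        simp [derivedPush, hh, ← act_mul, hδ]
      rw [hR]
      simp [derivedPush, hg, hδ]

/-- The permutation of the set of reduced words induced by a generator. -/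
noncomputable def derivedPushPerm (act_one : ∀ γ : Γ, act γ 1 = γ)
    (act_mul : ∀ (γ : Γ) (g h : G), act γ (g * h) = act (act γ g) h) (p : Γ × G) :
    Equiv.Perm {L : List (Γ × G) // DerivedReduced act L} where
  toFun L := ⟨derivedPush act p.1 p.2 L.1, L.2.push act_mul _ _⟩
  invFun L := ⟨derivedPush act (act p.1 p.2) p.2⁻¹ L.1, L.2.push act_mul _ _⟩
  left_inv L := Subtype.ext <| by
    have h := L.2.push_mul act_one act_mul (act p.1 p.2) p.2⁻¹ p.2
    rw [← act_mul, mul_inv_cancel, act_one, inv_mul_cancel, derivedPush_one] at h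
    exact h.symm
  right_inv L := Subtype.ext <| by
    have h := L.2.push_mul act_one act_mul p.1 p.2 p.2⁻¹
    rw [mul_inv_cancel, derivedPush_one] at h
    exact h.symm

/-- The action of the derived group on reduced words. -/
noncomputable def derivedWordHom (act_one : ∀ γ : Γ, act γ 1 = γ)
    (act_mul : ∀ (γ : Γ) (g h : G), act γ (g * h) = act (act γ g) h) :
    DerivedGroup act →* Equiv.Perm {L : List (Γ × G) // DerivedReduced act L} :=
  PresentedGroup.toGroup (rels := derivedRels act) (f := derivedPushPerm act_one act_mul) <| by
    rintro _ ⟨γ, g, h, rfl⟩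
    rw [map_mul, map_inv, map_mul, mul_inv_eq_one]
    simp only [FreeGroup.lift_apply_of]
    ext1 L
    exact Subtype.ext (L.2.push_mul act_one act_mul γ g h)

theorem derivedWordHom_gen (act_one : ∀ γ : Γ, act γ 1 = γ)
    (act_mul : ∀ (γ : Γ) (g h : G), act γ (g * h) = act (act γ g) h) (p : Γ × G) :
    derivedWordHom act_one act_mul (derivedGen act p.1 p.2) =
      derivedPushPerm act_one act_mul p :=
  PresentedGroup.toGroup.of _

theorem derivedWordHom_prod_nil (act_one : ∀ γ : Γ, act γ 1 = γ)
    (act_mul : ∀ (γ : Γ) (g h : G), act γ (g * h) = act (act γ g) h)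
    (hnil : DerivedReduced act []) {L : List (Γ × G)} (hL : DerivedReduced act L) :
    (derivedWordHom act_one act_mul (L.map fun p => derivedGen act p.1 p.2).prod
      ⟨[], hnil⟩).1 = L := by
  induction L with
  | nil => simp
  | cons p T ih =>
    rw [List.map_cons, List.prod_cons, map_mul, Equiv.Perm.mul_apply, derivedWordHom_gen]
    change derivedPush act p.1 p.2 _ = _
    rw [ih hL.tail, hL.push_eq_cons]

end

/-- Normal forms in the derived group are unique. -/
theorem derived_normal_form_unique {Γ : Type*} {G : Type*} [Group G] [Nonempty Γ]
    (act : Γ → G → Γ)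
    (act_one : ∀ γ : Γ, act γ 1 = γ)
    (act_mul : ∀ (γ : Γ) (g h : G), act γ (g * h) = act (act γ g) h)
    (L M : List (Γ × G))
    (hL₁ : ∀ p ∈ L, p.2 ≠ 1)
    (hL₂ : L.Chain' (fun p q => q.1 ≠ act p.1 p.2))
    (hM₁ : ∀ p ∈ M, p.2 ≠ 1)
    (hM₂ : M.Chain' (fun p q => q.1 ≠ act p.1 p.2))
    (h : (L.map fun p => derivedGen act p.1 p.2).prod
        = (M.map fun p => derivedGen act p.1 p.2).prod) :
    L = M := by
  have hnil : DerivedReduced act [] := by simp [DerivedReduced]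
  rw [← derivedWordHom_prod_nil act_one act_mul hnil ⟨hL₁, hL₂⟩, h,
    derivedWordHom_prod_nil act_one act_mul hnil ⟨hM₁, hM₂⟩]
end

section
/- Suppose in addition that Γ carries a semigroup multiplication and that the right G-action satisfies (γγ')·g = γ(γ'·g) for all γ, γ' ∈ Γ and g ∈ G. Then for every γ ∈ Γ there is a unique group endomorphism φ_γ of the derived group G_ρ satisfying φ_γ(g^{γ'}) = g^{γγ'} for all g ∈ G and γ' ∈ Γ, and these endomorphisms satisfy φ_{γ₁γ₂} = φ_{γ₁} ∘ φ_{γ₂} for all γ₁, γ₂ ∈ Γ (so G_ρ is a Γ-group). -/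
theorem DerivedGroup.hom_ext {Γ : Type*} {G : Type*} [Group G] {act : Γ → G → Γ}
    {H : Type*} [Group H] {φ ψ : DerivedGroup act →* H}
    (h : ∀ (γ : Γ) (g : G), φ (derivedGen act γ g) = ψ (derivedGen act γ g)) : φ = ψ :=
  PresentedGroup.ext (rels := derivedRels act) fun x => h x.1 x.2

/-- A family `f` satisfying the relations of the derived group extends to a homomorphism. -/
theorem DerivedGroup.exists_hom {Γ : Type*} {G : Type*} [Group G] {act : Γ → G → Γ}
    {H : Type*} [Group H] (f : Γ → G → H)
    (hf : ∀ (γ : Γ) (g h : G), f γ (g * h) = f γ g * f (act γ g) h) :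
    ∃ φ : DerivedGroup act →* H, ∀ (γ : Γ) (g : G), φ (derivedGen act γ g) = f γ g := by
  have hrels : ∀ r ∈ derivedRels act, FreeGroup.lift (fun x : Γ × G => f x.1 x.2) r = 1 := by
    rintro r ⟨γ, g, h, rfl⟩
    simp only [map_mul, map_inv, FreeGroup.lift_apply_of]
    rw [hf, mul_inv_cancel]
  exact ⟨PresentedGroup.toGroup hrels, fun _ _ => PresentedGroup.toGroup.of hrels⟩

/-- When `Γ` is a semigroup and the action satisfies `(γγ')·g = γ(γ'·g)`, left
multiplication by `γ` on coordinates induces a unique endomorphism `φ_γ` of the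
derived group, and `φ_{γ₁γ₂} = φ_{γ₁} ∘ φ_{γ₂}`, so `G_ρ` is a `Γ`-group. -/
theorem derived_operator_semigroup {Γ : Type*} {G : Type*} [Group G] [Semigroup Γ]
    (act : Γ → G → Γ)
    (act_one : ∀ γ : Γ, act γ 1 = γ)
    (act_mul : ∀ (γ : Γ) (g h : G), act γ (g * h) = act (act γ g) h)
    (act_compat : ∀ (γ γ' : Γ) (g : G), act (γ * γ') g = γ * act γ' g) :
    (∀ γ : Γ, ∃! φ : DerivedGroup act →* DerivedGroup act,
      ∀ (g : G) (γ' : Γ), φ (derivedGen act γ' g) = derivedGen act (γ * γ') g) ∧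
    (∀ (γ₁ γ₂ : Γ) (φ₁ φ₂ φ₁₂ : DerivedGroup act →* DerivedGroup act),
      (∀ (g : G) (γ' : Γ), φ₁ (derivedGen act γ' g) = derivedGen act (γ₁ * γ') g) →
      (∀ (g : G) (γ' : Γ), φ₂ (derivedGen act γ' g) = derivedGen act (γ₂ * γ') g) →
      (∀ (g : G) (γ' : Γ), φ₁₂ (derivedGen act γ' g) = derivedGen act (γ₁ * γ₂ * γ') g) →
      φ₁₂ = φ₁.comp φ₂) := by
  refine ⟨fun γ => ?_, fun γ₁ γ₂ φ₁ φ₂ φ₁₂ h₁ h₂ h₁₂ => ?_⟩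
  · obtain ⟨φ, hφ⟩ := DerivedGroup.exists_hom (act := act)
      (fun γ' g => derivedGen act (γ * γ') g)
      (fun γ' g h => by rw [derivedGen_mul, act_compat])
    exact ⟨φ, fun g γ' => hφ γ' g, fun ψ hψ =>
      DerivedGroup.hom_ext fun γ' g => (hψ g γ').trans (hφ γ' g).symm⟩
  · refine DerivedGroup.hom_ext fun γ' g => ?_
    rw [MonoidHom.comp_apply, h₂, h₁, h₁₂, mul_assoc]
end

section
/- Let x ∈ G satisfy P(x) = 1 and let N be the normal closure in the derived group G_ρ of the set {x^n : n ∈ ℤ}. Then the composite of the map k ↦ k^0 with the quotient projection G_ρ → G_ρ/N is a group isomorphism from ker P onto G_ρ/N. -/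
namespace DerivedGroup

section General

variable {Γ G : Type*} [Group G] (act : Γ → G → Γ)

theorem gen_mul (γ : Γ) (g h : G) :
    derivedGen act γ (g * h) = derivedGen act γ g * derivedGen act (act γ g) h := by
  have hr := PresentedGroup.one_of_mem (rels := derivedRels act) ⟨γ, g, h, rfl⟩
  rw [map_mul, map_inv, mul_inv_eq_one, map_mul] at hr
  exact hr

variable {act}

/-- A crossed family `f γ (g * h) = f γ g * f (γ·g) h` extends to the derived group. -/
def lift {H : Type*} [Group H] (f : Γ → G → H)
    (hf : ∀ γ g h, f γ (g * h) = f γ g * f (act γ g) h) : DerivedGroup act →* H :=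
  PresentedGroup.toGroup (f := fun p : Γ × G => f p.1 p.2) <| by
    rintro _ ⟨γ, g, h, rfl⟩
    simp [hf]

@[simp]
theorem lift_gen {H : Type*} [Group H] (f : Γ → G → H)
    (hf : ∀ γ g h, f γ (g * h) = f γ g * f (act γ g) h) (γ : Γ) (g : G) :
    lift f hf (derivedGen act γ g) = f γ g :=
  PresentedGroup.toGroup.of _

theorem hom_ext_s11 {H : Type*} [Group H] {φ ψ : DerivedGroup act →* H}
    (h : ∀ γ g, φ (derivedGen act γ g) = ψ (derivedGen act γ g)) : φ = ψ :=
  PresentedGroup.ext fun p => h p.1 p.2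

end General

variable {G : Type*} [Group G] {P : G →* Multiplicative ℤ} {act : ℤ → G → ℤ} {x : G}

/-- The map `k ↦ k^0` on the kernel of `P`. -/
def kerHom (hact : ∀ (n : ℤ) (g : G), act n g = n + Multiplicative.toAdd (P g)) :
    P.ker →* DerivedGroup act :=
  MonoidHom.mk' (fun k => derivedGen act 0 (k : G)) fun k l => by
    rw [Subgroup.coe_mul, gen_mul, hact, MonoidHom.mem_ker.1 k.2, toAdd_one, add_zero]

/-- The map `g^n ↦ x^n * g * x^{-(n + P g)}` onto the kernel of `P`. -/
def toKer (hact : ∀ (n : ℤ) (g : G), act n g = n + Multiplicative.toAdd (P g))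
    (hx : P x = Multiplicative.ofAdd 1) : DerivedGroup act →* P.ker :=
  lift (fun n g => ⟨x ^ n * g * (x ^ act n g)⁻¹, by
      rw [MonoidHom.mem_ker]
      apply Multiplicative.toAdd.injective
      simp [hx, hact]⟩)
    fun n g h => Subtype.ext <| by
      have hm : act (act n g) h = act n (g * h) := by simp [hact, add_assoc]
      simp [hm, mul_assoc]

theorem toKer_gen_meridian (hact : ∀ (n : ℤ) (g : G), act n g = n + Multiplicative.toAdd (P g))
    (hx : P x = Multiplicative.ofAdd 1) (n : ℤ) : toKer hact hx (derivedGen act n x) = 1 := by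
  apply Subtype.ext
  simp [toKer, hact, hx, zpow_add_one]

theorem toKer_kerHom (hact : ∀ (n : ℤ) (g : G), act n g = n + Multiplicative.toAdd (P g))
    (hx : P x = Multiplicative.ofAdd 1) (k : P.ker) : toKer hact hx (kerHom hact k) = k := by
  apply Subtype.ext
  simp [toKer, kerHom, hact, MonoidHom.mem_ker.1 k.2]

/-- A homomorphism killing every `x^n` kills every `(x^m)^n`. -/
theorem map_gen_zpow {H : Type*} [Group H]
    (hact : ∀ (n : ℤ) (g : G), act n g = n + Multiplicative.toAdd (P g))
    (φ : DerivedGroup act →* H) (hφ : ∀ n, φ (derivedGen act n x) = 1) (m n : ℤ) :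
    φ (derivedGen act n (x ^ m)) = 1 := by
  have hone (n : ℤ) : derivedGen act n (1 : G) = 1 := by
    have h := gen_mul act n 1 1
    simpa [hact] using h
  induction m generalizing n with
  | zero => simp [hone]
  | succ i ih => rw [zpow_add_one, gen_mul, map_mul, ih, hφ, one_mul]
  | pred i ih =>
    have h := ih n
    rw [← sub_add_cancel (-(i : ℤ)) 1, zpow_add_one, gen_mul, map_mul, hφ, mul_one] at h
    exact h

/-- Modulo the generators `x^n`, the composite of `toKer` and `kerHom` is trivial. -/
theorem map_kerHom_toKer {H : Type*} [Group H]
    (hact : ∀ (n : ℤ) (g : G), act n g = n + Multiplicative.toAdd (P g))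
    (hx : P x = Multiplicative.ofAdd 1)
    (φ : DerivedGroup act →* H) (hφ : ∀ n, φ (derivedGen act n x) = 1) :
    (φ.comp (kerHom hact)).comp (toKer hact hx) = φ := by
  refine hom_ext_s11 fun n g => ?_
  have h0 : act 0 (x ^ n) = n := by simp [hact, hx]
  simp only [toKer, kerHom, MonoidHom.comp_apply, lift_gen, MonoidHom.mk'_apply]
  rw [← zpow_neg, gen_mul, gen_mul, map_mul, map_mul, map_gen_zpow hact φ hφ,
    map_gen_zpow hact φ hφ, h0, one_mul, mul_one]

end DerivedGroup

/-- For `P : G → ℤ` surjective, `x` with `P(x) = 1`, and `N` the normal closure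
of `{x^n : n ∈ ℤ}` in the derived group, the map `k ↦ k^0 · N` is an
isomorphism from `ker P` onto `G_ρ/N`. -/
theorem derived_mod_meridian_iso_ker {G : Type*} [Group G]
    (P : G →* Multiplicative ℤ) (hP : Function.Surjective P)
    (act : ℤ → G → ℤ)
    (hact : ∀ (n : ℤ) (g : G), act n g = n + Multiplicative.toAdd (P g))
    (x : G) (hx : P x = Multiplicative.ofAdd 1) :
    ∃ e : P.ker ≃*
        (DerivedGroup act ⧸
          Subgroup.normalClosure {z : DerivedGroup act | ∃ n : ℤ, z = derivedGen act n x}),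
      ∀ k : P.ker,
        e k = QuotientGroup.mk' _ (derivedGen act 0 (k : G)) := by
  let N := Subgroup.normalClosure {z : DerivedGroup act | ∃ n : ℤ, z = derivedGen act n x}
  have hφ (n : ℤ) : QuotientGroup.mk' N (derivedGen act n x) = 1 :=
    (QuotientGroup.eq_one_iff _).2 (Subgroup.subset_normalClosure ⟨n, rfl⟩)
  have hN : N ≤ (DerivedGroup.toKer hact hx).ker := by
    refine Subgroup.normalClosure_le_normal ?_
    rintro _ ⟨n, rfl⟩
    exact DerivedGroup.toKer_gen_meridian hact hx n
  refine ⟨MonoidHom.toMulEquiv ((QuotientGroup.mk' N).comp (DerivedGroup.kerHom hact))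
    (QuotientGroup.lift N (DerivedGroup.toKer hact hx) hN) ?_ ?_, fun _ => rfl⟩
  · ext1 k
    exact DerivedGroup.toKer_kerHom hact hx k
  · refine QuotientGroup.monoidHom_ext _ ?_
    exact DerivedGroup.map_kerHom_toKer hact hx _ hφ
end
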